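/- arXiv:1709.09357 — 5 statements merged into one kernel-verified Lean document; each statement's English description precedes it below -/
import Mathlib

section
/- For every natural number n ≥ 4, with f₀ = (1/n^n)·(n^n - n²)/(n - 1) + 2√n/n^n and f₁ = 2√n/n² + (1/n²)·(1/n^n)·(n^n - n²)/(n - 1), one has f₁ ≤ (2/√n)·f₀. -/
/-- For `n ≥ 4`, with
`f₀ = (1/nⁿ)(nⁿ - n²)/(n-1) + 2√n/nⁿ` and `f₁ = 2√n/n² + (1/n²)(1/nⁿ)(nⁿ - n²)/(n-1)`,
one has `f₁ ≤ (2/√n) f₀`. -/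
theorem stmt11 (n : ℕ) (hn : 4 ≤ n) :
    2 * Real.sqrt n / (n : ℝ) ^ 2 +
        (1 / (n : ℝ) ^ 2) * ((1 / (n : ℝ) ^ n) * (((n : ℝ) ^ n - (n : ℝ) ^ 2) / ((n : ℝ) - 1))) ≤
      (2 / Real.sqrt n) *
        ((1 / (n : ℝ) ^ n) * (((n : ℝ) ^ n - (n : ℝ) ^ 2) / ((n : ℝ) - 1)) +
          2 * Real.sqrt n / (n : ℝ) ^ n) := by
  have hn4 : (4 : ℝ) ≤ n := by exact_mod_cast hn
  have hpow : (n : ℝ) ^ 4 ≤ (n : ℝ) ^ n := pow_le_pow_right₀ (by linarith) hn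
  obtain ⟨s, hs⟩ : ∃ s, s = √(n : ℝ) := ⟨_, rfl⟩
  have hsq : (n : ℝ) = s ^ 2 := by rw [hs, Real.sq_sqrt (Nat.cast_nonneg n)]
  have hs2 : 2 ≤ s := by
    rw [hs]
    exact Real.le_sqrt_of_sq_le (by linarith)
  rw [← hs]
  generalize (n : ℝ) ^ n = N at *
  rw [hsq] at hpow ⊢
  have hs0 : 0 < s := by linarith
  have hs1 : 0 < s ^ 2 - 1 := by nlinarith
  have hN : 0 < N := lt_of_lt_of_le (by positivity) hpow
  have hcubic : s ^ 4 * (2 * s ^ 3 - 4 * s ^ 2 + 3) ≤ (2 * s - 1) * N :=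
    calc s ^ 4 * (2 * s ^ 3 - 4 * s ^ 2 + 3) ≤ s ^ 4 * s ^ 4 := by
          gcongr
          nlinarith [pow_pos hs0 3]
      _ = (s ^ 2) ^ 4 := by ring
      _ ≤ N := hpow
      _ ≤ (2 * s - 1) * N := le_mul_of_one_le_left hN.le (by linarith)
  rw [← sub_nonneg]
  have hdiff : 2 / s * (1 / N * ((N - (s ^ 2) ^ 2) / (s ^ 2 - 1)) + 2 * s / N) -
      (2 * s / (s ^ 2) ^ 2 + 1 / (s ^ 2) ^ 2 * (1 / N * ((N - (s ^ 2) ^ 2) / (s ^ 2 - 1)))) =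
      ((2 * s - 1) * N - s ^ 4 * (2 * s ^ 3 - 4 * s ^ 2 + 3)) / (N * s ^ 4 * (s ^ 2 - 1)) := by
    have := hs1.ne'
    field_simp
    ring
  rw [hdiff]
  exact div_nonneg (sub_nonneg.2 hcubic) (by positivity)
end

section
/- Let n ≥ 3 be an odd natural number and let ν : ℤ/nℤ → ℝ be the probability with ν(1) = ν(-1) = 1/2 and ν(s) = 0 otherwise. Then for every natural number k with k ≥ n²/40, the total variation distance satisfies (1/2)·∑_{s ∈ ℤ/nℤ} |ν^{⋆k}(s) - 1/n| ≤ exp(-π²k/(2n²)). -/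
/-- Convolution of two functions on `ℤ/nℤ`: `(ν ⋆ μ)(s) = ∑_t ν(s - t) μ(t)`. -/
def zmodConv {n : ℕ} [NeZero n] (ν μ : ZMod n → ℝ) : ZMod n → ℝ :=
  fun s => ∑ t : ZMod n, ν (s - t) * μ t

/-- Convolution powers of `ν` on `ℤ/nℤ`: `ν^{⋆0} = δ₀` and `ν^{⋆(k+1)} = ν ⋆ ν^{⋆k}`
(so `ν^{⋆1} = ν`). -/
def zmodConvPow {n : ℕ} [NeZero n] (ν : ZMod n → ℝ) : ℕ → ZMod n → ℝ
  | 0 => fun s => if s = 0 then 1 else 0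
  | k + 1 => zmodConv ν (zmodConvPow ν k)

open Real in
/-- A Gaussian upper bound for the cosine on the first quarter period. -/
lemma cos_le_exp_neg_sq_div_two {x : ℝ} (h0 : 0 ≤ x) (h1 : x ≤ π / 2) :
    cos x ≤ exp (-x ^ 2 / 2) := by
  have hd (y : ℝ) : HasDerivAt (fun y => exp (y ^ 2 / 2) * cos y)
      (exp (y ^ 2 / 2) * (y * cos y - sin y)) y := by
    have h : HasDerivAt (fun y : ℝ => y ^ 2 / 2) y y := by
      have := (hasDerivAt_pow 2 y).div_const 2
      simpa using this
    exact (h.exp.mul (hasDerivAt_cos y)).congr_deriv (by ring)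
  have hanti : AntitoneOn (fun y => exp (y ^ 2 / 2) * cos y) (Set.Icc 0 (π / 2)) := by
    refine antitoneOn_of_deriv_nonpos (convex_Icc _ _) (by fun_prop)
      (fun y _ => (hd y).differentiableAt.differentiableWithinAt) fun y hy => ?_
    rw [interior_Icc] at hy
    rw [(hd y).deriv]
    have hcos : 0 < cos y := cos_pos_of_mem_Ioo ⟨by linarith [hy.1, pi_pos], hy.2⟩
    have htan := le_tan hy.1.le hy.2
    rw [tan_eq_sin_div_cos, le_div_iff₀ hcos] at htan
    exact mul_nonpos_of_nonneg_of_nonpos (exp_pos _).le (by linarith)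
  have h := hanti ⟨le_rfl, by positivity⟩ ⟨h0, h1⟩ h0
  simp only [ne_eq, OfNat.ofNat_ne_zero, not_false_eq_true, zero_pow, zero_div, exp_zero,
    cos_zero, mul_one] at h
  rw [neg_div, exp_neg, ← one_div, le_div_iff₀' (exp_pos _)]
  exact h

open ZMod Finset in
/-- A polarized form of Parseval's identity for the discrete Fourier transform. -/
lemma sum_dft_neg_mul_dft {n : ℕ} [NeZero n] (Φ : ZMod n → ℂ) :
    ∑ j, 𝓕 Φ (-j) * 𝓕 Φ j = n * ∑ s, Φ s ^ 2 := by
  have h (s : ZMod n) : ∑ j, stdAddChar (s * j) * 𝓕 Φ j = n * Φ s := by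
    have := congrFun (dft_dft Φ) (-s)
    rw [dft_apply] at this
    simpa [mul_comm s] using this
  calc ∑ j, 𝓕 Φ (-j) * 𝓕 Φ j = ∑ j, ∑ s, Φ s * (stdAddChar (s * j) * 𝓕 Φ j) := by
        refine sum_congr rfl fun j _ => ?_
        rw [dft_apply Φ (-j), sum_mul]
        refine sum_congr rfl fun s _ => ?_
        simp only [mul_neg, neg_neg, smul_eq_mul]
        ring
    _ = n * ∑ s, Φ s ^ 2 := by
        rw [sum_comm, mul_sum]
        refine sum_congr rfl fun s _ => ?_
        rw [← mul_sum, h]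
        ring

open ZMod Finset in
lemma dft_zmodConv {n : ℕ} [NeZero n] (f g : ZMod n → ℝ) (j : ZMod n) :
    𝓕 (fun s => (zmodConv f g s : ℂ)) j
      = 𝓕 (fun s => (f s : ℂ)) j * 𝓕 (fun s => (g s : ℂ)) j := by
  simp only [dft_apply, zmodConv, smul_eq_mul, Complex.ofReal_sum, Complex.ofReal_mul, mul_sum,
    sum_mul]
  rw [sum_comm]
  refine sum_congr rfl fun t _ => ?_
  rw [← Equiv.sum_comp (Equiv.addRight t)]
  refine sum_congr rfl fun s _ => ?_
  simp only [Equiv.coe_addRight, add_sub_cancel_right, add_mul, neg_add, AddChar.map_add_eq_mul]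
  ring

open ZMod Finset in
lemma dft_zmodConvPow {n : ℕ} [NeZero n] (f : ZMod n → ℝ) (k : ℕ) (j : ZMod n) :
    𝓕 (fun s => (zmodConvPow f k s : ℂ)) j = 𝓕 (fun s => (f s : ℂ)) j ^ k := by
  induction k with
  | zero => simp [dft_apply, zmodConvPow, apply_ite]
  | succ k ih => rw [pow_succ', ← ih, ← dft_zmodConv]; rfl

open ZMod Finset in
lemma dft_const {n : ℕ} [NeZero n] (c : ℂ) (j : ZMod n) :
    𝓕 (fun _ : ZMod n => c) j = if j = 0 then n * c else 0 := by
  have h := AddChar.sum_mulShift (-j) (isPrimitive_stdAddChar n)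
  simp only [dft_apply, smul_eq_mul, ← sum_mul]
  simp only [mul_neg, neg_eq_zero, ZMod.card] at h
  rw [h]
  split_ifs <;> simp

open ZMod Finset Real in
/-- The Fourier transform of the simple random walk measure on the circle. -/
lemma dft_simpleWalk {n : ℕ} [NeZero n] (hn : 3 ≤ n) (j : ZMod n) :
    𝓕 (fun s : ZMod n => ((if s = 1 ∨ s = -1 then (1 : ℝ) / 2 else 0 : ℝ) : ℂ)) j
      = (cos (2 * π * j.val / n) : ℂ) := by
  have : Fact (2 < n) := ⟨hn⟩
  have hne : (1 : ZMod n) ≠ -1 := (ZMod.neg_one_ne_one).symm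
  have hs (s : ZMod n) : ((if s = 1 ∨ s = -1 then (1 : ℝ) / 2 else 0 : ℝ) : ℂ)
      = (if s = 1 then (1 : ℂ) / 2 else 0) + (if s = -1 then (1 : ℂ) / 2 else 0) := by
    by_cases h1 : s = 1
    · subst h1; simp [hne]
    · by_cases h2 : s = -1 <;> simp [h1, h2, hne.symm]
  have hj : stdAddChar j = Complex.exp (((2 * π * j.val / n : ℝ) : ℂ) * Complex.I) := by
    rw [stdAddChar_apply, toCircle_apply]
    congr 1
    push_cast
    ring
  simp only [dft_apply, hs, smul_eq_mul, mul_add, sum_add_distrib, mul_ite, mul_zero,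
    sum_ite_eq', mem_univ, if_true, one_mul, neg_mul, neg_neg]
  rw [Complex.ofReal_cos, Complex.cos, AddChar.map_neg_eq_inv, hj, neg_mul, ← Complex.exp_neg]
  ring

open Real in
/-- Doubling a residue doubles the angle, up to sign of the cosine. -/
lemma cos_sq_val_two_mul {n : ℕ} [NeZero n] (j : ZMod n) :
    cos (π * (2 * j).val / n) ^ 2 = cos (2 * π * j.val / n) ^ 2 := by
  have hn0 : (n : ℝ) ≠ 0 := NeZero.ne _
  have hval : (2 * j).val = 2 * j.val % n := by
    conv_lhs => rw [← ZMod.natCast_zmod_val j]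
    rw [← Nat.cast_ofNat, ← Nat.cast_mul, ZMod.val_natCast]
  have hdiv : (2 * j.val : ℝ) = n * (2 * j.val / n : ℕ) + (2 * j).val := by
    rw [hval]
    exact_mod_cast (Nat.div_add_mod (2 * j.val) n).symm
  have harg : 2 * (2 * π * j.val / n)
      = 2 * (π * (2 * j).val / n) + (2 * j.val / n : ℕ) * (2 * π) := by
    have : 2 * π * j.val / n = π * (2 * j.val) / n := by ring
    rw [this, hdiv]
    field_simp
    ring
  rw [cos_sq, cos_sq, harg, cos_add_nat_mul_two_pi]

open Finset in
lemma ZMod.sum_val {n : ℕ} [NeZero n] {M : Type*} [AddCommMonoid M] (f : ℕ → M) :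
    ∑ j : ZMod n, f j.val = ∑ i ∈ range n, f i := by
  refine sum_bij (fun j _ => j.val) (fun j _ => mem_range.2 j.val_lt)
    (fun _ _ _ _ h => ZMod.val_injective n h)
    (fun i hi => ⟨i, mem_univ _, ZMod.val_cast_of_lt (mem_range.1 hi)⟩) (fun _ _ => rfl)

open Finset in
lemma ZMod.sum_two_mul {n : ℕ} [NeZero n] (hodd : Odd n) {M : Type*} [AddCommMonoid M]
    (f : ZMod n → M) : ∑ j, f (2 * j) = ∑ j, f j := by
  have h := Equiv.sum_comp (Units.mulLeft (ZMod.unitOfCoprime 2 hodd.coprime_two_left)) f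
  simpa using h

open Real in
/-- Gaussian decay of the powers of the cosine at multiples `π i / n`, centred at the nearer
of the two ends `0` and `n`. -/
lemma cos_sq_pow_le {n i : ℕ} (hn : 0 < n) (hi : i ≤ n) (k : ℕ) :
    (cos (π * i / n) ^ 2) ^ k ≤ exp (-(π ^ 2 * k / n ^ 2) * i ^ 2)
      + exp (-(π ^ 2 * k / n ^ 2) * (n - i) ^ 2) := by
  have hn' : (0 : ℝ) < n := by exact_mod_cast hn
  have hi' : (i : ℝ) ≤ n := by exact_mod_cast hi
  have key {x : ℝ} (h0 : 0 ≤ x) (h1 : 2 * x ≤ n) :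
      (cos (π * x / n) ^ 2) ^ k ≤ exp (-(π ^ 2 * k / n ^ 2) * x ^ 2) := by
    have hle : π * x / n ≤ π / 2 := by
      rw [div_le_div_iff₀ hn' two_pos]
      nlinarith [pi_pos]
    have hx : 0 ≤ π * x / n := by positivity
    have hcos : 0 ≤ cos (π * x / n) := cos_nonneg_of_mem_Icc ⟨by linarith [pi_pos], hle⟩
    have h := pow_le_pow_left₀ hcos (cos_le_exp_neg_sq_div_two hx hle) (2 * k)
    rw [← pow_mul]
    refine h.trans_eq ?_
    rw [← exp_nat_mul]
    congr 1
    push_cast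
    field_simp
  rcases le_total (2 * (i : ℝ)) n with h | h
  · exact (key (Nat.cast_nonneg i) h).trans (le_add_of_nonneg_right (exp_pos _).le)
  · have harg : π * i / n = π - π * (n - i) / n := by field_simp; ring
    rw [harg, cos_pi_sub, neg_sq]
    exact (key (by linarith) (by linarith)).trans (le_add_of_nonneg_left (exp_pos _).le)

open Finset in
lemma sum_range_pow_le_two {r : ℝ} (h0 : 0 ≤ r) (h1 : r ≤ 1 / 2) (m : ℕ) :
    ∑ i ∈ range m, r ^ i ≤ 2 := by
  have h := geom_sum_mul_neg r m
  have hp : 0 ≤ r ^ m := pow_nonneg h0 m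
  have hs : 0 ≤ ∑ i ∈ range m, r ^ i := sum_nonneg fun i _ => pow_nonneg h0 i
  nlinarith

open Real in
lemma exp_neg_mul_sq_succ_le {a : ℝ} (ha : 0 ≤ a) (i : ℕ) :
    exp (-a * (i + 1 : ℝ) ^ 2) ≤ exp (-a) * exp (-3 * a) ^ i := by
  rw [← exp_nat_mul, ← exp_add, exp_le_exp]
  have : (i : ℝ) ≤ i ^ 2 := by exact_mod_cast Nat.le_self_pow two_ne_zero i
  nlinarith [mul_le_mul_of_nonneg_left this ha]

open Real Finset in
lemma sum_cos_sq_pow_le {m k : ℕ} (hk : ((m + 1 : ℕ) : ℝ) ^ 2 / 40 ≤ k) :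
    ∑ i ∈ range m, (cos (π * (i + 1 : ℕ) / (m + 1 : ℕ)) ^ 2) ^ k
      ≤ 4 * exp (-(π ^ 2 * k / ((m + 1 : ℕ) : ℝ) ^ 2)) := by
  set a : ℝ := π ^ 2 * k / ((m + 1 : ℕ) : ℝ) ^ 2 with ha
  have ha0 : 0 ≤ a := by positivity
  have hr : exp (-3 * a) ≤ 1 / 2 := by
    have hn2 : (0 : ℝ) < ((m + 1 : ℕ) : ℝ) ^ 2 := by positivity
    have hpi : 9.6 ≤ π ^ 2 := by nlinarith [pi_gt_d2]
    have h1 : 0.24 ≤ a := by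
      rw [ha, le_div_iff₀ hn2]
      nlinarith [mul_le_mul_of_nonneg_right hpi (Nat.cast_nonneg (α := ℝ) k)]
    rw [one_div, ← exp_log (two_pos : (0 : ℝ) < 2), ← exp_neg, exp_le_exp]
    linarith [log_two_lt_d9]
  have hterm (i : ℕ) (hi : i ∈ range m) :
      (cos (π * (i + 1 : ℕ) / (m + 1 : ℕ)) ^ 2) ^ k
        ≤ exp (-a) * exp (-3 * a) ^ i + exp (-a) * exp (-3 * a) ^ (m - 1 - i) := by
    have hi := mem_range.1 hi
    refine (cos_sq_pow_le m.succ_pos (by omega) k).trans (add_le_add ?_ ?_)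
    · have h := exp_neg_mul_sq_succ_le ha0 i
      rw [ha] at h ⊢
      exact_mod_cast h
    · have hsub : ((m + 1 : ℕ) : ℝ) - (i + 1 : ℕ) = (m - 1 - i : ℕ) + 1 := by
        rw [sub_eq_iff_eq_add]
        norm_cast
        omega
      rw [Nat.succ_eq_add_one, hsub]
      exact exp_neg_mul_sq_succ_le ha0 _
  refine (sum_le_sum hterm).trans ?_
  rw [sum_add_distrib, ← mul_sum, ← mul_sum, sum_range_reflect (fun i => exp (-3 * a) ^ i) m]
  nlinarith [mul_le_mul_of_nonneg_left (sum_range_pow_le_two (exp_pos _).le hr m) (exp_pos (-a)).le]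

open ZMod Finset Real in
/-- The squared `ℓ²` distance to uniformity, as a sum over the nontrivial frequencies. -/
lemma card_mul_sum_sq_zmodConvPow_sub {n : ℕ} [NeZero n] (hn : 3 ≤ n) (k : ℕ) :
    n * ∑ s : ZMod n, (zmodConvPow (fun s : ZMod n => if s = 1 ∨ s = -1 then (1 : ℝ) / 2 else 0)
        k s - 1 / n) ^ 2
      = ∑ j : ZMod n, if j = 0 then 0 else (cos (2 * π * j.val / n) ^ 2) ^ k := by
  set ν : ZMod n → ℝ := fun s => if s = 1 ∨ s = -1 then (1 : ℝ) / 2 else 0 with hν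
  have hn0 : (n : ℂ) ≠ 0 := NeZero.ne _
  set Φ : ZMod n → ℂ := fun s => ((zmodConvPow ν k s - 1 / n : ℝ) : ℂ) with hΦ
  have hdft (j : ZMod n) :
      𝓕 Φ j = if j = 0 then 0 else ((cos (2 * π * j.val / n) ^ k : ℝ) : ℂ) := by
    have hsplit : Φ = (fun s => (zmodConvPow ν k s : ℂ)) - fun _ => (1 / n : ℂ) := by
      funext s
      simp [hΦ]
    rw [hsplit, map_sub, Pi.sub_apply, dft_zmodConvPow, dft_const, hν, dft_simpleWalk hn]
    split_ifs with h
    · simp [h, hn0]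
    · simp
  have heven (j : ZMod n) : 𝓕 Φ (-j) = 𝓕 Φ j := by
    rw [hdft, hdft]
    by_cases h : j = 0
    · simp [h]
    · have : NeZero j := ⟨h⟩
      have harg : 2 * π * ((n : ℝ) - j.val) / n = 2 * π - 2 * π * j.val / n := by
        have : (n : ℝ) ≠ 0 := NeZero.ne _
        field_simp
      rw [if_neg h, if_neg (neg_ne_zero.2 h), ZMod.val_neg_of_ne_zero,
        Nat.cast_sub j.val_lt.le, harg, cos_two_pi_sub]
  have hmain := sum_dft_neg_mul_dft Φ
  simp only [heven] at hmain
  apply Complex.ofReal_injective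
  push_cast
  have hcast : (n : ℂ) * ∑ s, Φ s ^ 2
      = n * ∑ s, ((zmodConvPow ν k s : ℂ) - 1 / n) ^ 2 := by simp [hΦ]
  rw [← hcast, ← hmain]
  refine sum_congr rfl fun j _ => ?_
  rw [hdft]
  split_ifs
  · simp
  · push_cast
    ring

/-- Upper bound for the simple random walk on the circle `ℤ/nℤ` (`n` odd, `n ≥ 3`)
driven by `ν(±1) = 1/2`: for `k ≥ n²/40`,
`‖ν^{⋆k} - π‖_TV ≤ exp(-π²k/(2n²))`. -/
theorem stmt14 (n : ℕ) [NeZero n] (hn : 3 ≤ n) (hodd : Odd n)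
    (ν : ZMod n → ℝ) (hν : ν = fun s => if s = 1 ∨ s = -1 then (1 : ℝ) / 2 else 0)
    (k : ℕ) (hk : (n : ℝ) ^ 2 / 40 ≤ (k : ℝ)) :
    (1 / 2) * ∑ s : ZMod n, |zmodConvPow ν k s - 1 / (n : ℝ)| ≤
      Real.exp (-(Real.pi ^ 2) * k / (2 * (n : ℝ) ^ 2)) := by
  subst hν
  set f : ZMod n → ℝ := fun s =>
    zmodConvPow (fun s => if s = 1 ∨ s = -1 then (1 : ℝ) / 2 else 0) k s - 1 / n with hf
  have hsq : n * ∑ s, f s ^ 2 ≤ 4 * Real.exp (-(Real.pi ^ 2 * k / (n : ℝ) ^ 2)) := by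
    have hfreq := card_mul_sum_sq_zmodConvPow_sub hn k
    have hdouble (j : ZMod n) :
        (if j = 0 then 0 else (Real.cos (2 * Real.pi * j.val / n) ^ 2) ^ k)
          = if (2 * j).val = 0 then 0 else
            (Real.cos (Real.pi * (2 * j).val / n) ^ 2) ^ k := by
      have h2 : 2 * j = 0 ↔ j = 0 := by
        have := (ZMod.unitOfCoprime 2 hodd.coprime_two_left).mul_right_eq_zero (a := j)
        simpa using this
      simp only [ZMod.val_eq_zero, h2, cos_sq_val_two_mul]
    simp only [hdouble] at hfreq
    rw [ZMod.sum_two_mul hodd (fun j : ZMod n => if j.val = 0 then (0 : ℝ) else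
        (Real.cos (Real.pi * j.val / n) ^ 2) ^ k),
      ZMod.sum_val (fun i => if i = 0 then (0 : ℝ) else
        (Real.cos (Real.pi * i / n) ^ 2) ^ k)] at hfreq
    rw [hfreq]
    obtain ⟨m, rfl⟩ : ∃ m, n = m + 1 := ⟨n - 1, by omega⟩
    rw [Finset.sum_range_succ']
    simpa using sum_cos_sq_pow_le hk
  have hcs := sq_sum_le_card_mul_sum_sq (s := Finset.univ) (f := fun s => |f s|)
  simp only [sq_abs, Finset.card_univ, ZMod.card] at hcs
  refine abs_le_of_sq_le_sq' ?_ (Real.exp_pos _).le |>.2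
  have hexp : Real.exp (-(Real.pi ^ 2) * k / (2 * (n : ℝ) ^ 2)) ^ 2
      = Real.exp (-(Real.pi ^ 2 * k / (n : ℝ) ^ 2)) := by
    rw [← Real.exp_nat_mul]
    congr 1
    push_cast
    field_simp
  rw [hexp, mul_pow]
  linarith
end

section
/- Let n ≥ 7 be an odd natural number and let ν : ℤ/nℤ → ℝ be the probability with ν(1) = ν(-1) = 1/2 and ν(s) = 0 otherwise. Then for every natural number k ≥ 1, the total variation distance satisfies (1/2)·∑_{s ∈ ℤ/nℤ} |ν^{⋆k}(s) - 1/n| ≥ (1/2)·exp(-π²k/(2n²) - π⁴k/(2n⁴)). -/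
/-- The pairing with a character turns convolution into multiplication. -/
theorem sum_zmodConv_mul_addChar {n : ℕ} [NeZero n] (ν μ : ZMod n → ℝ)
    (χ : AddChar (ZMod n) ℂ) :
    ∑ s, (zmodConv ν μ s : ℂ) * χ s = (∑ s, (ν s : ℂ) * χ s) * ∑ s, (μ s : ℂ) * χ s := by
  simp only [zmodConv, Complex.ofReal_sum, Complex.ofReal_mul, Finset.sum_mul]
  rw [Finset.sum_comm]
  simp only [Finset.mul_sum]
  rw [Finset.sum_comm (s := (Finset.univ : Finset (ZMod n)))
    (f := fun s t => (ν s : ℂ) * χ s * ((μ t : ℂ) * χ t))]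
  refine Finset.sum_congr rfl fun t _ => ?_
  refine Fintype.sum_equiv (Equiv.subRight t) _ _ fun s => ?_
  have h : χ s = χ (s - t) * χ t := by rw [← AddChar.map_add_eq_mul, sub_add_cancel]
  rw [h, Equiv.subRight_apply]
  ring

/-- The Fourier coefficients of a convolution power are powers of Fourier coefficients. -/
theorem sum_zmodConvPow_mul_addChar {n : ℕ} [NeZero n] (ν : ZMod n → ℝ)
    (χ : AddChar (ZMod n) ℂ) (k : ℕ) :
    ∑ s, (zmodConvPow ν k s : ℂ) * χ s = (∑ s, (ν s : ℂ) * χ s) ^ k := by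
  induction k with
  | zero => simp [zmodConvPow, apply_ite Complex.ofReal]
  | succ k ih => rw [zmodConvPow, sum_zmodConv_mul_addChar, ih, pow_succ']

/-- The `ℓ¹` distance to the uniform distribution dominates every nontrivial Fourier
coefficient. -/
theorem norm_sum_mul_addChar_le {n : ℕ} [NeZero n] (μ : ZMod n → ℝ)
    {χ : AddChar (ZMod n) ℂ} (hχ : χ ≠ 0) :
    ‖∑ s, (μ s : ℂ) * χ s‖ ≤ ∑ s, |μ s - 1 / (n : ℝ)| := by
  have h : ∑ s, (μ s : ℂ) * χ s = ∑ s, ((μ s - 1 / (n : ℝ) : ℝ) : ℂ) * χ s := by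
    simp only [Complex.ofReal_sub, sub_mul, Finset.sum_sub_distrib, ← Finset.mul_sum,
      AddChar.sum_eq_zero_of_ne_one (ψ := χ) hχ, mul_zero, sub_zero]
  rw [h]
  refine (norm_sum_le _ _).trans (Finset.sum_le_sum fun s _ => ?_)
  rw [norm_mul, AddChar.norm_apply, mul_one, Complex.norm_real, Real.norm_eq_abs]

theorem Real.exp_neg_sq_div_two_sub_le_cos {x : ℝ} (hx : x ^ 2 ≤ 1) :
    Real.exp (-(x ^ 2 / 2 + x ^ 4 / 2)) ≤ Real.cos x := by
  have hy : 0 < 1 + (x ^ 2 / 2 + x ^ 4 / 2) := by positivity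
  have hexp := Real.add_one_le_exp (x ^ 2 / 2 + x ^ 4 / 2)
  calc Real.exp (-(x ^ 2 / 2 + x ^ 4 / 2))
      ≤ (1 + (x ^ 2 / 2 + x ^ 4 / 2))⁻¹ := by
        rw [Real.exp_neg]
        exact inv_anti₀ hy (by linarith)
    _ ≤ 1 - x ^ 2 / 2 := by
        rw [inv_le_iff_one_le_mul₀ hy]
        nlinarith [mul_nonneg (sq_nonneg (x ^ 2)) (sub_nonneg.2 hx)]
    _ ≤ Real.cos x := Real.one_sub_sq_div_two_le_cos

/-- The Fourier coefficient of the simple random walk on `ℤ/nℤ`. -/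
theorem sum_simpleRandomWalk_mul_addChar {n : ℕ} [NeZero n] (hn : 2 < n)
    (χ : AddChar (ZMod n) ℂ) :
    ∑ s : ZMod n, ((if s = 1 ∨ s = -1 then (1 : ℝ) / 2 else 0 : ℝ) : ℂ) * χ s =
      (χ 1 + χ (-1)) / 2 := by
  have : Fact (2 < n) := ⟨hn⟩
  have hne : (1 : ZMod n) ≠ -1 := (ZMod.neg_one_ne_one).symm
  have h : ∀ s : ZMod n, ((if s = 1 ∨ s = -1 then (1 : ℝ) / 2 else 0 : ℝ) : ℂ) * χ s =
      if s ∈ ({1, -1} : Finset (ZMod n)) then χ s / 2 else 0 := by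
    intro s
    simp only [Finset.mem_insert, Finset.mem_singleton]
    split_ifs
    · push_cast
      ring
    · simp
  rw [Finset.sum_congr rfl fun s _ => h s, Finset.sum_ite_mem, Finset.univ_inter,
    Finset.sum_pair hne]
  ring

/-- For odd `n`, some nontrivial character of `ℤ/nℤ` sends `±1` to points whose mean is
`-cos (π / n)`. -/
theorem exists_addChar_mean_eq_neg_cos {n : ℕ} [NeZero n] (hn : 2 < n) (hodd : Odd n) :
    ∃ χ : AddChar (ZMod n) ℂ, χ ≠ 0 ∧
      (χ 1 + χ (-1)) / 2 = -(Real.cos (Real.pi / n) : ℂ) := by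
  obtain ⟨j, hj⟩ := hodd
  have hn0 : (n : ℂ) ≠ 0 := Nat.cast_ne_zero.2 (NeZero.ne n)
  refine ⟨AddChar.mulShift ZMod.stdAddChar (j : ZMod n), ?_, ?_⟩
  · refine ZMod.isPrimitive_stdAddChar n fun h => ?_
    have := Nat.le_of_dvd (by omega) ((ZMod.natCast_eq_zero_iff j n).1 h)
    omega
  · have h1 := ZMod.stdAddChar_coe (N := n) (j : ℤ)
    have h2 := ZMod.stdAddChar_coe (N := n) (-j : ℤ)
    push_cast at h1 h2
    have hangle : 2 * Real.pi * Complex.I * j / n =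
        (Real.pi - Real.pi / n : ℂ) * Complex.I := by
      have hnj : (n : ℂ) = 2 * j + 1 := by exact_mod_cast hj
      field_simp
      rw [hnj]
      ring
    rw [AddChar.mulShift_apply, AddChar.mulShift_apply, mul_one, mul_neg, mul_one, h1, h2,
      mul_neg, neg_div, hangle, ← neg_mul, ← Complex.cos, Complex.cos_pi_sub]
    push_cast
    rfl

/-- Lower bound for the simple random walk on the circle `ℤ/nℤ` (`n` odd, `n ≥ 7`)
driven by `ν(±1) = 1/2`: for every `k ≥ 1`,
`‖ν^{⋆k} - π‖_TV ≥ (1/2) exp(-π²k/(2n²) - π⁴k/(2n⁴))`. -/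
theorem stmt15 (n : ℕ) [NeZero n] (hn : 7 ≤ n) (hodd : Odd n)
    (ν : ZMod n → ℝ) (hν : ν = fun s => if s = 1 ∨ s = -1 then (1 : ℝ) / 2 else 0)
    (k : ℕ) (hk : 1 ≤ k) :
    (1 / 2) * ∑ s : ZMod n, |zmodConvPow ν k s - 1 / (n : ℝ)| ≥
      (1 / 2) * Real.exp (-(Real.pi ^ 2) * k / (2 * (n : ℝ) ^ 2)
        - Real.pi ^ 4 * k / (2 * (n : ℝ) ^ 4)) := by
  obtain ⟨χ, hχ, hmean⟩ := exists_addChar_mean_eq_neg_cos (n := n) (by omega) hodd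
  have hbound := norm_sum_mul_addChar_le (zmodConvPow ν k) hχ
  have hnR : (7 : ℝ) ≤ n := by exact_mod_cast hn
  have hx : (Real.pi / n) ^ 2 ≤ 1 := by
    have h1 : Real.pi / n ≤ 1 := by
      rw [div_le_one (by linarith)]
      linarith [Real.pi_le_four]
    exact pow_le_one₀ (by positivity) h1
  have hcos := Real.exp_neg_sq_div_two_sub_le_cos hx
  have hnonneg := (Real.exp_pos _).le.trans hcos
  have hcoeff : ∑ s, (ν s : ℂ) * χ s = -(Real.cos (Real.pi / n) : ℂ) := by
    rw [hν, ← hmean]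
    exact sum_simpleRandomWalk_mul_addChar (by omega) χ
  rw [sum_zmodConvPow_mul_addChar, hcoeff, norm_pow, norm_neg, Complex.norm_real,
    Real.norm_of_nonneg hnonneg] at hbound
  refine mul_le_mul_of_nonneg_left (le_trans ?_ hbound) (by norm_num)
  calc Real.exp (-(Real.pi ^ 2) * k / (2 * (n : ℝ) ^ 2) - Real.pi ^ 4 * k / (2 * (n : ℝ) ^ 4))
      = Real.exp (-((Real.pi / n) ^ 2 / 2 + (Real.pi / n) ^ 4 / 2)) ^ k := by
        rw [← Real.exp_nat_mul]
        congr 1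
        field_simp
        ring
    _ ≤ Real.cos (Real.pi / n) ^ k := pow_le_pow_left₀ (Real.exp_pos _).le hcos k
end

section
/- Let n ≥ 2 be a natural number and let ν : (ℤ/2ℤ)ⁿ → ℝ be the probability with ν(s) = 1/(n+1) if the weight w(s) = ∑_i s_i of s is 0 or 1, and ν(s) = 0 otherwise. Then for every real c > 0 and every natural number k with k ≥ (n+1)(log n + c)/4, the total variation distance satisfies ((1/2)·∑_{s ∈ (ℤ/2ℤ)ⁿ} |ν^{⋆k}(s) - 1/2ⁿ|)² ≤ (1/2)·(exp(exp(-c)) - 1). -/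
/-- Convolution of two functions on the `n`-cube `(ℤ/2ℤ)ⁿ`:
`(ν ⋆ μ)(s) = ∑_t ν(s - t) μ(t)`. -/
def cubeConv {n : ℕ} (ν μ : (Fin n → ZMod 2) → ℝ) : (Fin n → ZMod 2) → ℝ :=
  fun s => ∑ t : Fin n → ZMod 2, ν (s - t) * μ t

/-- Convolution powers on the `n`-cube: `ν^{⋆0} = δ₀`, `ν^{⋆(k+1)} = ν ⋆ ν^{⋆k}`
(so `ν^{⋆1} = ν`). -/
def cubeConvPow {n : ℕ} (ν : (Fin n → ZMod 2) → ℝ) : ℕ → (Fin n → ZMod 2) → ℝ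
  | 0 => fun s => if s = 0 then 1 else 0
  | k + 1 => cubeConv ν (cubeConvPow ν k)

/-- The weight of `s ∈ (ℤ/2ℤ)ⁿ`: the number of coordinates equal to `1`. -/
def cubeWeight {n : ℕ} (s : Fin n → ZMod 2) : ℕ := ∑ i, (s i).val

/-- The nontrivial character of `ℤ/2ℤ`. -/
def zmodTwoSign (a : ZMod 2) : ℝ := if a = 0 then 1 else -1

/-- The character of the cube attached to a set of coordinates. -/
def cubeChar {n : ℕ} (T : Finset (Fin n)) (s : Fin n → ZMod 2) : ℝ :=
  ∏ i ∈ T, zmodTwoSign (s i)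

/-- The Fourier transform on the cube. -/
def cubeFourier {n : ℕ} (f : (Fin n → ZMod 2) → ℝ) (T : Finset (Fin n)) : ℝ :=
  ∑ s, f s * cubeChar T s

lemma zmodTwo_eq_zero_or_one (a : ZMod 2) : a = 0 ∨ a = 1 := by
  revert a; decide

lemma zmodTwoSign_add (a b : ZMod 2) :
    zmodTwoSign (a + b) = zmodTwoSign a * zmodTwoSign b := by
  have h : (1 + 1 : ZMod 2) = 0 := by decide
  rcases zmodTwo_eq_zero_or_one a with rfl | rfl <;>
    rcases zmodTwo_eq_zero_or_one b with rfl | rfl <;> simp [zmodTwoSign, h]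

lemma one_add_zmodTwoSign_mul (a b : ZMod 2) :
    1 + zmodTwoSign a * zmodTwoSign b = if a = b then 2 else 0 := by
  rcases zmodTwo_eq_zero_or_one a with rfl | rfl <;>
    rcases zmodTwo_eq_zero_or_one b with rfl | rfl <;> norm_num [zmodTwoSign]

lemma sum_zmodTwoSign : ∑ a, zmodTwoSign a = 0 := by
  have h : (Finset.univ : Finset (ZMod 2)) = {0, 1} := by decide
  rw [h]
  simp [zmodTwoSign]

lemma cubeChar_add {n : ℕ} (T : Finset (Fin n)) (s t : Fin n → ZMod 2) :
    cubeChar T (s + t) = cubeChar T s * cubeChar T t := by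
  simp [cubeChar, zmodTwoSign_add, Finset.prod_mul_distrib]

lemma sum_cubeChar_mul {n : ℕ} (s t : Fin n → ZMod 2) :
    ∑ T : Finset (Fin n), cubeChar T s * cubeChar T t = if s = t then 2 ^ n else 0 := by
  simp only [cubeChar, ← Finset.prod_mul_distrib]
  rw [← Finset.powerset_univ, ← Finset.prod_one_add]
  simp only [one_add_zmodTwoSign_mul]
  split_ifs with h
  · simp [h]
  · obtain ⟨i, hi⟩ := Function.ne_iff.mp h
    exact Finset.prod_eq_zero (Finset.mem_univ i) (by simp [hi])

lemma sum_cubeChar {n : ℕ} {T : Finset (Fin n)} (hT : T.Nonempty) :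
    ∑ s : Fin n → ZMod 2, cubeChar T s = 0 := by
  obtain ⟨i, hi⟩ := hT
  have h : ∀ s : Fin n → ZMod 2,
      cubeChar T s = ∏ j, if j ∈ T then zmodTwoSign (s j) else 1 := by
    intro s
    simp [cubeChar, Finset.prod_ite_mem]
  simp only [h]
  rw [← Fintype.piFinset_univ,
    ← Finset.prod_univ_sum (fun _ => Finset.univ)
      (fun j a => if j ∈ T then zmodTwoSign a else (1 : ℝ))]
  exact Finset.prod_eq_zero (Finset.mem_univ i) (by simp [hi, sum_zmodTwoSign])

/-- Plancherel's identity on the cube. -/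
lemma sum_cubeFourier_sq {n : ℕ} (f : (Fin n → ZMod 2) → ℝ) :
    ∑ T, cubeFourier f T ^ 2 = 2 ^ n * ∑ s, f s ^ 2 := by
  calc ∑ T, cubeFourier f T ^ 2
      = ∑ T, ∑ s, ∑ t, f s * f t * (cubeChar T s * cubeChar T t) := by
        refine Finset.sum_congr rfl fun T _ => ?_
        rw [sq, cubeFourier, Finset.sum_mul_sum]
        refine Finset.sum_congr rfl fun s _ => Finset.sum_congr rfl fun t _ => ?_
        ring
    _ = ∑ s, ∑ t, f s * f t * ∑ T, cubeChar T s * cubeChar T t := by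
        rw [Finset.sum_comm]
        refine Finset.sum_congr rfl fun s _ => ?_
        rw [Finset.sum_comm]
        simp only [Finset.mul_sum]
    _ = 2 ^ n * ∑ s, f s ^ 2 := by
        simp only [sum_cubeChar_mul, mul_ite, mul_zero, Finset.sum_ite_eq, Finset.mem_univ,
          if_true, Finset.mul_sum]
        refine Finset.sum_congr rfl fun s _ => ?_
        ring

lemma cubeFourier_cubeConv {n : ℕ} (f g : (Fin n → ZMod 2) → ℝ) (T : Finset (Fin n)) :
    cubeFourier (cubeConv f g) T = cubeFourier f T * cubeFourier g T := by
  simp only [cubeFourier, cubeConv, Finset.sum_mul]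
  rw [Finset.sum_comm]
  simp only [Finset.mul_sum]
  rw [Finset.sum_comm (γ := Fin n → ZMod 2) (s := Finset.univ) (t := Finset.univ)
    (f := fun s t => f s * cubeChar T s * (g t * cubeChar T t))]
  refine Finset.sum_congr rfl fun t _ => ?_
  refine Fintype.sum_equiv (Equiv.subRight t) _ _ fun s => ?_
  have h : cubeChar T s = cubeChar T (s - t) * cubeChar T t := by
    rw [← cubeChar_add, sub_add_cancel]
  simp only [Equiv.subRight_apply, h]
  ring

lemma cubeFourier_cubeConvPow {n : ℕ} (f : (Fin n → ZMod 2) → ℝ) (k : ℕ)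
    (T : Finset (Fin n)) : cubeFourier (cubeConvPow f k) T = cubeFourier f T ^ k := by
  induction k with
  | zero => simp [cubeFourier, cubeConvPow, cubeChar, zmodTwoSign]
  | succ k ih => rw [cubeConvPow, cubeFourier_cubeConv, ih, pow_succ']

lemma cubeWeight_eq_zero_iff {n : ℕ} (s : Fin n → ZMod 2) : cubeWeight s = 0 ↔ s = 0 := by
  simp [cubeWeight, funext_iff]

lemma cubeWeight_single {n : ℕ} (i : Fin n) :
    cubeWeight (Pi.single i 1 : Fin n → ZMod 2) = 1 := by
  rw [cubeWeight, Finset.sum_eq_single i]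
  · simp [ZMod.val_one]
  · intro j _ hj
    simp [Pi.single_eq_of_ne hj]
  · simp

lemma exists_single_of_cubeWeight_eq_one {n : ℕ} {s : Fin n → ZMod 2}
    (hs : cubeWeight s = 1) : ∃ i, Pi.single i 1 = s := by
  have hne : s ≠ 0 := fun h => by
    rw [(cubeWeight_eq_zero_iff s).2 h] at hs
    exact zero_ne_one hs
  obtain ⟨i, hi⟩ := Function.ne_iff.mp hne
  have hi1 : s i = 1 := (zmodTwo_eq_zero_or_one (s i)).resolve_left hi
  refine ⟨i, funext fun j => ?_⟩
  rcases eq_or_ne j i with rfl | hj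
  · simp [hi1]
  · rw [cubeWeight, ← Finset.add_sum_erase _ _ (Finset.mem_univ i), hi1, ZMod.val_one] at hs
    have h0 : ∑ l ∈ Finset.univ.erase i, (s l).val = 0 := by omega
    have := Finset.sum_eq_zero_iff.mp h0 j (by simp [hj])
    rw [Pi.single_eq_of_ne hj]
    exact ((ZMod.val_eq_zero _).mp this).symm

lemma filter_cubeWeight_le_one (n : ℕ) :
    (Finset.univ.filter fun s : Fin n → ZMod 2 => cubeWeight s = 0 ∨ cubeWeight s = 1) =
      insert 0 (Finset.univ.image fun i => Pi.single i 1) := by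
  ext s
  simp only [Finset.mem_filter, Finset.mem_univ, true_and, Finset.mem_insert, Finset.mem_image,
    cubeWeight_eq_zero_iff]
  refine or_congr_right ⟨exists_single_of_cubeWeight_eq_one, ?_⟩
  rintro ⟨i, rfl⟩
  exact cubeWeight_single i

lemma sum_cubeWeight_le_one {n : ℕ} (f : (Fin n → ZMod 2) → ℝ) :
    ∑ s ∈ Finset.univ.filter (fun s => cubeWeight s = 0 ∨ cubeWeight s = 1), f s =
      f 0 + ∑ i, f (Pi.single i 1) := by
  rw [filter_cubeWeight_le_one, Finset.sum_insert, Finset.sum_image]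
  · intro i _ j _ hij
    by_contra hne
    have := congrFun hij i
    simp [Pi.single_eq_of_ne hne] at this
  · simp

lemma cubeChar_single {n : ℕ} (T : Finset (Fin n)) (i : Fin n) :
    cubeChar T (Pi.single i 1) = 1 - if i ∈ T then 2 else 0 := by
  have h : ∀ j, zmodTwoSign ((Pi.single i 1 : Fin n → ZMod 2) j) = if j = i then -1 else 1 := by
    intro j
    rcases eq_or_ne j i with rfl | hj
    · simp [zmodTwoSign]
    · simp [zmodTwoSign, hj]
  simp only [cubeChar, h, Finset.prod_ite_eq']
  split_ifs <;> norm_num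

lemma cubeFourier_nearestNeighbour {n : ℕ} (T : Finset (Fin n)) :
    cubeFourier (fun s : Fin n → ZMod 2 =>
      if cubeWeight s = 0 ∨ cubeWeight s = 1 then (1 : ℝ) / (n + 1) else 0) T =
      1 - 2 * (T.card : ℝ) / (n + 1) := by
  have hn : (n : ℝ) + 1 ≠ 0 := by positivity
  simp only [cubeFourier, ite_mul, zero_mul]
  rw [← Finset.sum_filter, ← Finset.mul_sum, sum_cubeWeight_le_one]
  have h0 : cubeChar T 0 = 1 := by simp [cubeChar, zmodTwoSign]
  simp only [h0, cubeChar_single, Finset.sum_sub_distrib, Finset.sum_const, Finset.card_univ,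
    Fintype.card_fin, Finset.sum_ite_mem, Finset.univ_inter, nsmul_eq_mul]
  field_simp
  ring

/-- The upper bound lemma for a measure of total mass one. -/
lemma cube_upper_bound {n : ℕ} (f : (Fin n → ZMod 2) → ℝ) (hf : cubeFourier f ∅ = 1) :
    (∑ s, |f s - 1 / (2 : ℝ) ^ n|) ^ 2 ≤
      ∑ T ∈ Finset.univ.erase ∅, cubeFourier f T ^ 2 := by
  set g : (Fin n → ZMod 2) → ℝ := fun s => f s - 1 / (2 : ℝ) ^ n with hg
  have hcard : Fintype.card (Fin n → ZMod 2) = 2 ^ n := by simp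
  have hsub : ∀ T, cubeFourier g T =
      cubeFourier f T - 1 / (2 : ℝ) ^ n * ∑ s, cubeChar T s := by
    intro T
    simp only [cubeFourier, hg, sub_mul, Finset.sum_sub_distrib, Finset.mul_sum]
  have h0 : cubeFourier g ∅ = 0 := by
    rw [hsub, hf]
    simp [cubeChar]
  calc (∑ s, |g s|) ^ 2 ≤ 2 ^ n * ∑ s, g s ^ 2 := by
        have := sq_sum_le_card_mul_sum_sq (s := Finset.univ) (f := fun s => |g s|)
        simpa [hcard] using this
    _ = ∑ T, cubeFourier g T ^ 2 := (sum_cubeFourier_sq g).symm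
    _ = ∑ T ∈ Finset.univ.erase ∅, cubeFourier g T ^ 2 := by
        rw [← Finset.add_sum_erase _ _ (Finset.mem_univ ∅), h0]
        simp
    _ = ∑ T ∈ Finset.univ.erase ∅, cubeFourier f T ^ 2 := by
        refine Finset.sum_congr rfl fun T hT => ?_
        rw [hsub, sum_cubeChar (Finset.nonempty_iff_ne_empty.2 (Finset.ne_of_mem_erase hT))]
        simp

lemma sum_erase_empty_apply_card (n : ℕ) (F : ℕ → ℝ) :
    ∑ T ∈ (Finset.univ : Finset (Finset (Fin n))).erase ∅, F T.card =
      ∑ j ∈ Finset.range n, (n.choose (j + 1) : ℝ) * F (j + 1) := by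
  have h := Finset.sum_powerset_apply_card F (x := (Finset.univ : Finset (Fin n)))
  rw [Finset.powerset_univ, ← Finset.add_sum_erase _ _ (Finset.mem_univ ∅), Finset.card_univ,
    Fintype.card_fin, Finset.sum_range_succ'] at h
  simp only [Finset.card_empty, Nat.choose_zero_right, one_smul, nsmul_eq_mul] at h
  linarith

lemma one_sub_pow_le_exp {x : ℝ} (hx : x ≤ 1) (m : ℕ) :
    (1 - x) ^ m ≤ Real.exp (-(m * x)) := by
  rw [← mul_neg, Real.exp_nat_mul]
  refine pow_le_pow_left₀ (by linarith) ?_ m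
  linarith [Real.add_one_le_exp (-x)]

lemma pow_mul_exp_le {n k : ℕ} {c : ℝ} (hn : 0 < n)
    (hk : ((n : ℝ) + 1) * (Real.log n + c) / 4 ≤ (k : ℝ)) (j : ℕ) :
    (n : ℝ) ^ j * Real.exp (-((2 * k : ℕ) * (2 * (j : ℝ) / (n + 1)))) ≤ Real.exp (-c) ^ j := by
  have hn0 : (0 : ℝ) < n := by exact_mod_cast hn
  have h1 : Real.log n + c ≤ 4 * k / (n + 1) := by
    rw [le_div_iff₀ (by positivity)]
    linarith
  have h2 : -(((2 * k : ℕ) : ℝ) * (2 * (j : ℝ) / (n + 1))) = j * (-(4 * k / (n + 1))) := by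
    push_cast
    ring
  rw [h2, Real.exp_nat_mul, ← mul_pow]
  refine pow_le_pow_left₀ (by positivity) ?_ j
  calc (n : ℝ) * Real.exp (-(4 * k / (n + 1)))
      = Real.exp (Real.log n + -(4 * k / (n + 1))) := by rw [Real.exp_add, Real.exp_log hn0]
    _ ≤ Real.exp (-c) := Real.exp_le_exp.2 (by linarith)

lemma choose_mul_le_of_le {n k j m : ℕ} {c : ℝ} (hn : 0 < n)
    (hk : ((n : ℝ) + 1) * (Real.log n + c) / 4 ≤ (k : ℝ)) (hm : 2 * m ≤ n + 1)
    (hj : (n.choose j : ℝ) ≤ (n : ℝ) ^ m / m.factorial) :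
    (n.choose j : ℝ) * (1 - 2 * (m : ℝ) / (n + 1)) ^ (2 * k) ≤
      Real.exp (-c) ^ m / m.factorial := by
  have hx : 2 * (m : ℝ) / (n + 1) ≤ 1 := by
    rw [div_le_one (by positivity)]
    exact_mod_cast hm
  calc (n.choose j : ℝ) * (1 - 2 * (m : ℝ) / (n + 1)) ^ (2 * k)
      ≤ (n : ℝ) ^ m / m.factorial *
          Real.exp (-((2 * k : ℕ) * (2 * (m : ℝ) / (n + 1)))) :=
        mul_le_mul hj (one_sub_pow_le_exp hx _) (pow_nonneg (by linarith) _) (by positivity)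
    _ = ((n : ℝ) ^ m * Real.exp (-((2 * k : ℕ) * (2 * (m : ℝ) / (n + 1))))) /
          m.factorial := by ring
    _ ≤ _ := by
        gcongr
        exact pow_mul_exp_le hn hk m

lemma choose_le_reflected {n j : ℕ} (hj : j ≤ n) (hj0 : 0 < j) :
    (n.choose j : ℝ) ≤ (n : ℝ) ^ (n + 1 - j) / (n + 1 - j).factorial := by
  have hs : n + 1 - j = (n - j) + 1 := by omega
  rw [← Nat.choose_symm hj, hs]
  refine (Nat.choose_le_pow_div (α := ℝ) (n - j) n).trans ?_
  rw [div_le_div_iff₀ (by positivity) (by positivity), Nat.factorial_succ, pow_succ]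
  push_cast
  have h : ((n - j : ℕ) : ℝ) + 1 ≤ n := by
    exact_mod_cast (by omega : n - j + 1 ≤ n)
  have h2 : (0 : ℝ) ≤ (n : ℝ) ^ (n - j) * (n - j).factorial := by positivity
  nlinarith

lemma choose_mul_eigenvalue_le {n k j : ℕ} {c : ℝ}
    (hk : ((n : ℝ) + 1) * (Real.log n + c) / 4 ≤ (k : ℝ)) (hj0 : 0 < j) (hj : j ≤ n) :
    (n.choose j : ℝ) * (1 - 2 * (j : ℝ) / (n + 1)) ^ (2 * k) ≤
      Real.exp (-c) ^ j / j.factorial +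
        Real.exp (-c) ^ (n + 1 - j) / (n + 1 - j).factorial := by
  have hn : 0 < n := by omega
  have hp : ∀ m : ℕ, 0 ≤ Real.exp (-c) ^ m / m.factorial := fun m => by positivity
  rcases le_or_gt (2 * j) (n + 1) with h | h
  · linarith [choose_mul_le_of_le hn hk h (Nat.choose_le_pow_div (α := ℝ) j n), hp (n + 1 - j)]
  · have hr : 2 * (n + 1 - j) ≤ n + 1 := by omega
    have he : (1 - 2 * (j : ℝ) / (n + 1)) = -(1 - 2 * ((n + 1 - j : ℕ) : ℝ) / (n + 1)) := by
      rw [Nat.cast_sub (by omega)]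
      push_cast
      field_simp
      ring
    rw [he, (even_two_mul k).neg_pow]
    linarith [choose_mul_le_of_le hn hk hr (choose_le_reflected hj hj0), hp j]

lemma sum_range_pow_succ_div_factorial_le {x : ℝ} (hx : 0 ≤ x) (n : ℕ) :
    ∑ j ∈ Finset.range n, x ^ (j + 1) / (j + 1).factorial ≤ Real.exp x - 1 := by
  have h := Real.sum_le_exp_of_nonneg hx (n + 1)
  rw [Finset.sum_range_succ'] at h
  simp only [pow_zero, Nat.factorial_zero, Nat.cast_one, div_one] at h
  linarith

lemma sum_choose_mul_eigenvalue_le {n k : ℕ} {c : ℝ}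
    (hk : ((n : ℝ) + 1) * (Real.log n + c) / 4 ≤ (k : ℝ)) :
    ∑ j ∈ Finset.range n,
      (n.choose (j + 1) : ℝ) * (1 - 2 * ((j + 1 : ℕ) : ℝ) / (n + 1)) ^ (2 * k) ≤
      2 * (Real.exp (Real.exp (-c)) - 1) := by
  set F : ℕ → ℝ := fun j => Real.exp (-c) ^ (j + 1) / (j + 1).factorial with hF
  calc _ ≤ ∑ j ∈ Finset.range n, (F j + F (n - 1 - j)) := by
        refine Finset.sum_le_sum fun j hj => ?_
        have hj := Finset.mem_range.mp hj
        have h := choose_mul_eigenvalue_le (j := j + 1) hk (by omega) hj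
        rwa [show n + 1 - (j + 1) = n - 1 - j + 1 by omega] at h
    _ = 2 * ∑ j ∈ Finset.range n, F j := by
        rw [Finset.sum_add_distrib, Finset.sum_range_reflect, two_mul]
    _ ≤ _ := by
        gcongr
        exact sum_range_pow_succ_div_factorial_le (Real.exp_pos _).le n

/-- Upper bound for the nearest-neighbour walk on the `n`-cube `(ℤ/2ℤ)ⁿ` (`n ≥ 2`)
driven by `ν` uniform on the elements of weight `0` or `1`: for `c > 0` and
`k ≥ (n+1)(log n + c)/4`, `‖ν^{⋆k} - π‖_TV² ≤ (1/2)(e^{e^{-c}} - 1)`. -/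
theorem stmt16 (n : ℕ) (hn : 2 ≤ n)
    (ν : (Fin n → ZMod 2) → ℝ)
    (hν : ν = fun s => if cubeWeight s = 0 ∨ cubeWeight s = 1 then (1 : ℝ) / (n + 1) else 0)
    (c : ℝ) (hc : 0 < c) (k : ℕ)
    (hk : ((n : ℝ) + 1) * (Real.log n + c) / 4 ≤ (k : ℝ)) :
    ((1 / 2) * ∑ s : Fin n → ZMod 2, |cubeConvPow ν k s - 1 / (2 : ℝ) ^ n|) ^ 2 ≤
      (1 / 2) * (Real.exp (Real.exp (-c)) - 1) := by
  subst hν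
  have hhat := fun T : Finset (Fin n) => (cubeFourier_cubeConvPow _ k T).trans
    (congrArg (· ^ k) (cubeFourier_nearestNeighbour T))
  have hub := cube_upper_bound _ (by rw [hhat]; simp)
  simp only [hhat, ← pow_mul, mul_comm k 2] at hub
  rw [sum_erase_empty_apply_card n
    (fun j => (1 - 2 * (j : ℝ) / (n + 1)) ^ (2 * k))] at hub
  rw [mul_pow]
  linarith [hub.trans (sum_choose_mul_eigenvalue_le hk)]
end

section
/- Let n ≥ 3 be an odd natural number, let v be a natural number with 1 ≤ v ≤ (n-1)/2, let ζ = exp(2πi/n), and let A_v be the 2×2 complex matrix with rows (1 + ζ^{-v}, ζ^v + ζ^{2v}) and (ζ^{-v} + ζ^{-2v}, 1 + ζ^v). Then for every natural number k ≥ 1, Tr((A_v*)^k · A_v^k) = 4^{2k} · cos(πv/n)^{4k-2}, where A_v* is the conjugate transpose of A_v. -/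
open Matrix

theorem pow_succ_eq_smul_of_mul_self {R M : Type*} [CommSemiring R] [Semiring M] [Algebra R M]
    {t : R} {a : M} (h : a * a = t • a) (k : ℕ) : a ^ (k + 1) = t ^ k • a := by
  induction k with
  | zero => simp
  | succ k ih => rw [pow_succ, ih, smul_mul_assoc, h, smul_smul, pow_succ]

theorem mul_self_of_mul_eq_one {R : Type*} [CommRing R] {z w : R} (h : z * w = 1) :
    !![1 + w, z + z ^ 2; w + w ^ 2, 1 + z] * !![1 + w, z + z ^ 2; w + w ^ 2, 1 + z] =
      (2 + z + w) • !![1 + w, z + z ^ 2; w + w ^ 2, 1 + z] := by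
  ext i j
  fin_cases i <;> fin_cases j <;> simp [Matrix.mul_apply, Fin.sum_univ_two] <;> grind

theorem trace_conjTranspose_mul_self_of_mul_eq_one {R : Type*} [CommRing R] [StarRing R] {z w : R}
    (h : z * w = 1) (hz : star z = w) :
    trace (!![1 + w, z + z ^ 2; w + w ^ 2, 1 + z]ᴴ * !![1 + w, z + z ^ 2; w + w ^ 2, 1 + z]) =
      4 * (2 + z + w) := by
  have hw : star w = z := by rw [← hz, star_star]
  simp [Matrix.trace, Matrix.mul_apply, Fin.sum_univ_two, hz, hw]
  grind

theorem two_add_exp_add_exp_neg (x : ℂ) :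
    2 + Complex.exp (2 * x * Complex.I) + Complex.exp (-(2 * x * Complex.I)) =
      4 * Complex.cos x ^ 2 := by
  have h := Complex.two_cos (2 * x)
  rw [neg_mul, Complex.cos_two_mul] at h
  linear_combination -h

/-- For `n ≥ 3` odd, `1 ≤ v ≤ (n-1)/2`, `ζ = e^{2πi/n}` and
`A_v = ((1 + ζ^{-v}, ζ^v + ζ^{2v}), (ζ^{-v} + ζ^{-2v}, 1 + ζ^v))`, for every `k ≥ 1`
`Tr((A_v*)^k A_v^k) = 4^{2k} cos(πv/n)^{4k-2}`. -/
theorem stmt18 (n v : ℕ) (hn : 3 ≤ n) (hodd : Odd n) (hv1 : 1 ≤ v) (hv2 : v ≤ (n - 1) / 2)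
    (ζ : ℂ) (hζ : ζ = Complex.exp (2 * Real.pi * Complex.I / n))
    (A : Matrix (Fin 2) (Fin 2) ℂ)
    (hA : A = !![1 + ζ ^ (-(v : ℤ)), ζ ^ (v : ℤ) + ζ ^ (2 * v : ℤ);
                 ζ ^ (-(v : ℤ)) + ζ ^ (-(2 * v : ℤ)), 1 + ζ ^ (v : ℤ)])
    (k : ℕ) (hk : 1 ≤ k) :
    Matrix.trace ((Aᴴ) ^ k * A ^ k) =
      (4 : ℂ) ^ (2 * k) * ((Real.cos (Real.pi * v / n) : ℂ)) ^ (4 * k - 2) := by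
  obtain ⟨m, rfl⟩ : ∃ m, k = m + 1 := ⟨k - 1, by omega⟩
  have hζ0 : ζ ≠ 0 := hζ ▸ Complex.exp_ne_zero _
  have hz : ζ ^ v = Complex.exp (2 * ((Real.pi * v / n : ℝ) : ℂ) * Complex.I) := by
    rw [hζ, ← Complex.exp_nat_mul]
    congr 1
    push_cast
    ring
  have hw : (ζ ^ v)⁻¹ = Complex.exp (-(2 * ((Real.pi * v / n : ℝ) : ℂ) * Complex.I)) := by
    rw [hz, Complex.exp_neg]
  have hstar : star (ζ ^ v) = (ζ ^ v)⁻¹ := by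
    rw [hw, hz, Complex.star_def, ← Complex.exp_conj]
    simp [Complex.conj_ofNat]
  have hA' : A = !![1 + (ζ ^ v)⁻¹, ζ ^ v + (ζ ^ v) ^ 2;
      (ζ ^ v)⁻¹ + ((ζ ^ v)⁻¹) ^ 2, 1 + ζ ^ v] := by
    have h2 : (2 * v : ℤ) = ((v * 2 : ℕ) : ℤ) := by push_cast; ring
    rw [hA, h2]
    simp only [_root_.zpow_neg, zpow_natCast, pow_mul, inv_pow]
  have hmul := mul_inv_cancel₀ (pow_ne_zero v hζ0)
  have ht : 2 + ζ ^ v + (ζ ^ v)⁻¹ = 4 * (Real.cos (Real.pi * v / n) : ℂ) ^ 2 := by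
    rw [hw, hz, two_add_exp_add_exp_neg, Complex.ofReal_cos]
  have hsq := mul_self_of_mul_eq_one hmul
  have htr := trace_conjTranspose_mul_self_of_mul_eq_one hmul hstar
  rw [← hA', ht] at hsq htr
  rw [← conjTranspose_pow, pow_succ_eq_smul_of_mul_self hsq, conjTranspose_smul, smul_mul_smul_comm,
    trace_smul, htr, show 4 * (m + 1) - 2 = 4 * m + 2 by omega]
  simp only [star_pow, star_mul', Complex.star_def, Complex.conj_ofReal, map_ofNat, smul_eq_mul]
  ring
end
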